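/- Star–triangle relation for the IRF Boltzmann weights: with Λ the set of admissible sequences and the Boltzmann weights W̌ defined by W̌[λ+με_i; λ, ξ, λ+2με_i; λ+με_i] = θ₁(μ−ξ)θ₁'(0)/θ₁(μ), W̌[λ+με_i; λ, ξ, λ+μ(ε_i+ε_j); λ+με_i] = θ₁(λ_{ji}−ξ)θ₁'(0)/θ₁(λ_{ji}) (i≠j), W̌[λ+με_j; λ, ξ, λ+μ(ε_i+ε_j); λ+με_i] = θ₁(ξ)θ₁(λ_{ji}−μ)θ₁'(0)/(θ₁(λ_{ji})θ₁(−μ)) (i≠j), and 0 otherwise, one has for all λ,κ,ν,α,β,γ ∈ Λ and all ξ₁,ξ₂,ξ₃ ∈ ℂ: Σ_{κ'} W̌[κ'; κ,ξ₁₂,γ; ν]·W̌[α; λ,ξ₁₃,κ'; κ]·W̌[β; α,ξ₂₃,γ; κ'] = Σ_{κ'} W̌[κ'; λ,ξ₂₃,ν; κ]·W̌[β; κ',ξ₁₃,γ; ν]·W̌[α; λ,ξ₁₂,β; κ'], where ξ_{ab} = ξ_a − ξ_b and the sums, a priori over Λ, have only finitely many nonzero terms. -/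

import Mathlib

open Complex

/-- The Jacobi theta function `θ₁(z, τ)`. -/
noncomputable def theta1 (τ z : ℂ) : ℂ :=
  ∑' m : ℤ, Complex.exp (Real.pi * I * ((m : ℂ) + 1/2)^2 * τ
    + 2 * Real.pi * I * ((m : ℂ) + 1/2) * (z + 1/2))

/-- The sequence `λ + μ ε_i`. -/
noncomputable def shiftSeq (μ : ℝ) (lam : ℤ → ℂ) (i : ℤ) : ℤ → ℂ :=
  fun j => if j = i then lam j + (μ : ℂ) else lam j

open scoped Classical in
/-- The Boltzmann weight `W̌[κ'; λ, ξ, ν; κ]` of the IRF model. -/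
noncomputable def BW (τ : ℂ) (μ : ℝ) (κ' lam : ℤ → ℂ) (ξ : ℂ) (ν κ : ℤ → ℂ) : ℂ :=
  if ∃ i, κ = shiftSeq μ lam i ∧ κ' = shiftSeq μ lam i ∧
      ν = shiftSeq μ (shiftSeq μ lam i) i then
    theta1 τ ((μ : ℂ) - ξ) * deriv (theta1 τ) 0 / theta1 τ (μ : ℂ)
  else if h2 : ∃ i j, i ≠ j ∧ κ = shiftSeq μ lam i ∧ κ' = shiftSeq μ lam i ∧
      ν = shiftSeq μ (shiftSeq μ lam i) j then
    theta1 τ (lam h2.choose_spec.choose - lam h2.choose - ξ) * deriv (theta1 τ) 0 /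
      theta1 τ (lam h2.choose_spec.choose - lam h2.choose)
  else if h3 : ∃ i j, i ≠ j ∧ κ = shiftSeq μ lam i ∧ κ' = shiftSeq μ lam j ∧
      ν = shiftSeq μ (shiftSeq μ lam i) j then
    theta1 τ ξ * theta1 τ (lam h3.choose_spec.choose - lam h3.choose - (μ : ℂ)) *
        deriv (theta1 τ) 0 /
      (theta1 τ (lam h3.choose_spec.choose - lam h3.choose) * theta1 τ (-(μ : ℂ)))
  else 0

/-- The set `Λ` of admissible sequences. -/
def LamSet (τ : ℂ) (μ : ℝ) : Set (ℤ → ℂ) :=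
  {lam | (∀ i, |(lam i).im| < τ.im / 2) ∧
    ∀ i j, i ≠ j → ¬∃ a b : ℤ, lam i - lam j = (a : ℂ) + (b : ℂ) * (μ : ℂ)}

/-! ### The theta function -/

section Theta

variable {τ : ℂ}

/-- The general term of the series defining `theta1`. -/
noncomputable def theta1Term (τ z : ℂ) (m : ℤ) : ℂ :=
  Complex.exp (Real.pi * I * ((m : ℂ) + 1/2)^2 * τ
    + 2 * Real.pi * I * ((m : ℂ) + 1/2) * (z + 1/2))

lemma theta1Term_eq (τ z : ℂ) (m : ℤ) :
    theta1Term τ z m = Complex.exp (Real.pi * I * (τ / 4 + z + 1 / 2)) *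
      jacobiTheta₂_term m (z + 1 / 2 + τ / 2) τ := by
  rw [theta1Term, jacobiTheta₂_term, ← Complex.exp_add]
  ring_nf

lemma theta1_eq (τ z : ℂ) :
    theta1 τ z = Complex.exp (Real.pi * I * (τ / 4 + z + 1 / 2)) *
      jacobiTheta₂ (z + 1 / 2 + τ / 2) τ := by
  rw [jacobiTheta₂, ← tsum_mul_left]
  exact tsum_congr (theta1Term_eq τ z)

lemma summable_theta1Term (hτ : 0 < τ.im) (z : ℂ) : Summable (theta1Term τ z) := by
  rw [show theta1Term τ z = _ from funext (theta1Term_eq τ z)]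
  exact ((summable_jacobiTheta₂_term_iff _ τ).2 hτ).mul_left _

lemma differentiable_theta1 (hτ : 0 < τ.im) : Differentiable ℂ (theta1 τ) := by
  rw [show theta1 τ = _ from funext (theta1_eq τ)]
  intro z
  refine DifferentiableAt.mul (by fun_prop) ?_
  exact (differentiableAt_jacobiTheta₂_fst (z + 1 / 2 + τ / 2) hτ).comp z
    (f := fun z : ℂ => z + 1 / 2 + τ / 2) (by fun_prop)

lemma theta1_neg (τ z : ℂ) : theta1 τ (-z) = -theta1 τ z := by
  have h1 : -z + 1 / 2 + τ / 2 = -(z + 1 / 2 + τ / 2) + τ + 1 := by ring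
  rw [theta1_eq, theta1_eq, h1, jacobiTheta₂_add_left, jacobiTheta₂_add_left',
    jacobiTheta₂_neg_left, ← mul_assoc, ← neg_mul, ← Complex.exp_add]
  congr 1
  rw [show (Real.pi * I * (τ / 4 + -z + 1 / 2) + -Real.pi * I * (τ + 2 * -(z + 1 / 2 + τ / 2)) : ℂ)
    = Real.pi * I * (τ / 4 + z + 1 / 2) + Real.pi * I by ring, Complex.exp_add, Complex.exp_pi_mul_I]
  ring

lemma theta1_zero (τ : ℂ) : theta1 τ 0 = 0 := by
  have h := theta1_neg τ 0
  rw [neg_zero] at h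
  exact self_eq_neg.1 h

lemma theta1_add_one (τ z : ℂ) : theta1 τ (z + 1) = -theta1 τ z := by
  have h1 : z + 1 + 1 / 2 + τ / 2 = z + 1 / 2 + τ / 2 + 1 := by ring
  rw [theta1_eq, theta1_eq, h1, jacobiTheta₂_add_left, ← neg_mul]
  congr 1
  rw [show (Real.pi * I * (τ / 4 + (z + 1) + 1 / 2) : ℂ)
    = Real.pi * I * (τ / 4 + z + 1 / 2) + Real.pi * I by ring, Complex.exp_add, Complex.exp_pi_mul_I]
  ring

lemma theta1_add_period (τ z : ℂ) :
    theta1 τ (z + τ) = -Complex.exp (-Real.pi * I * (τ + 2 * z)) * theta1 τ z := by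
  have h1 : z + τ + 1 / 2 + τ / 2 = z + 1 / 2 + τ / 2 + τ := by ring
  rw [theta1_eq, theta1_eq, h1, jacobiTheta₂_add_left', ← mul_assoc, ← mul_assoc,
    ← Complex.exp_add, neg_mul (Complex.exp _), ← Complex.exp_add]
  congr 1
  rw [show (Real.pi * I * (τ / 4 + (z + τ) + 1 / 2) +
      -Real.pi * I * (τ + 2 * (z + 1 / 2 + τ / 2)) : ℂ)
    = -Real.pi * I * (τ + 2 * z) + Real.pi * I * (τ / 4 + z + 1 / 2) - Real.pi * I by ring,
    Complex.exp_sub, Complex.exp_pi_mul_I, div_neg, div_one]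

/-- Pairs of integers are parametrised by two copies of `ℤ × ℤ`, according to the parity of the
sum of the entries. -/
def paritySplit : (ℤ × ℤ) ⊕ (ℤ × ℤ) → ℤ × ℤ :=
  Sum.elim (fun p => (p.1 + p.2, p.1 - p.2 - 1)) (fun p => (p.1 + p.2, p.1 - p.2))

lemma paritySplit_bijective : Function.Bijective paritySplit := by
  constructor
  · rintro (⟨a, b⟩ | ⟨a, b⟩) (⟨c, d⟩ | ⟨c, d⟩) h <;>
      simp only [paritySplit, Sum.elim_inl, Sum.elim_inr, Prod.mk.injEq] at h
    · obtain ⟨rfl, rfl⟩ : a = c ∧ b = d := by omega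
      rfl
    · omega
    · omega
    · obtain ⟨rfl, rfl⟩ : a = c ∧ b = d := by omega
      rfl
  · rintro ⟨m, n⟩
    rcases Int.even_or_odd' (m + n) with ⟨c, hc | hc⟩
    · exact ⟨.inr (c, m - c), by simp only [paritySplit, Sum.elim_inr, Prod.mk.injEq]; omega⟩
    · exact ⟨.inl (c + 1, m - c - 1),
        by simp only [paritySplit, Sum.elim_inl, Prod.mk.injEq]; omega⟩

/-- Even-index half of the bilinear decomposition of `θ₁(x + y) θ₁(x - y)`. -/
noncomputable def thetaEven (τ x : ℂ) : ℂ := jacobiTheta₂ (2 * x) (2 * τ)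

/-- Odd-index half of the bilinear decomposition of `θ₁(x + y) θ₁(x - y)`. -/
noncomputable def thetaOdd (τ x : ℂ) : ℂ :=
  ∑' n : ℤ, Complex.exp (Real.pi * I * τ / 2 + 2 * Real.pi * I * x) *
    jacobiTheta₂_term n (2 * x + τ) (2 * τ)

lemma theta1_add_mul_theta1_sub (hτ : 0 < τ.im) (x y : ℂ) :
    theta1 τ (x + y) * theta1 τ (x - y) =
      thetaEven τ x * thetaOdd τ y - thetaOdd τ x * thetaEven τ y := by
  have hτ2 : 0 < (2 * τ).im := by simpa using hτ
  have hE (x : ℂ) : Summable (fun n => ‖jacobiTheta₂_term n (2 * x) (2 * τ)‖) :=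
    ((summable_jacobiTheta₂_term_iff _ _).2 hτ2).norm
  have hO (x : ℂ) : Summable (fun n : ℤ =>
      ‖Complex.exp (Real.pi * I * τ / 2 + 2 * Real.pi * I * x) *
        jacobiTheta₂_term n (2 * x + τ) (2 * τ)‖) :=
    (((summable_jacobiTheta₂_term_iff _ _).2 hτ2).mul_left _).norm
  have hT (z : ℂ) := (summable_theta1Term hτ z).norm
  have hl : theta1 τ (x + y) * theta1 τ (x - y) =
      ∑' z : ℤ × ℤ, theta1Term τ (x + y) z.1 * theta1Term τ (x - y) z.2 :=
    tsum_mul_tsum_of_summable_norm (hT _) (hT _)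
  have hs := summable_mul_of_summable_norm (hT (x + y)) (hT (x - y))
  let e := Equiv.ofBijective paritySplit paritySplit_bijective
  have hs' := (e.summable_iff).2 hs
  rw [hl, ← e.tsum_eq]
  refine (Summable.tsum_sum (hs'.comp_injective Sum.inl_injective)
    (hs'.comp_injective Sum.inr_injective)).trans ?_
  rw [thetaEven, jacobiTheta₂, thetaOdd,
    tsum_mul_tsum_of_summable_norm (hE x) (hO y), thetaOdd, thetaEven, jacobiTheta₂,
    tsum_mul_tsum_of_summable_norm (hO x) (hE y)]
  refine Eq.trans ?_ (sub_eq_add_neg _ _).symm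
  rw [← tsum_neg]
  congr 1
  · refine tsum_congr fun p => ?_
    change theta1Term τ (x + y) (p.1 + p.2) * theta1Term τ (x - y) (p.1 - p.2 - 1) = _
    simp only [theta1Term, jacobiTheta₂_term, ← Complex.exp_add]
    rw [Complex.exp_eq_exp_iff_exists_int]
    exact ⟨p.1, by push_cast; ring⟩
  · refine tsum_congr fun p => ?_
    change theta1Term τ (x + y) (p.1 + p.2) * theta1Term τ (x - y) (p.1 - p.2) = _
    simp only [theta1Term, jacobiTheta₂_term, ← Complex.exp_add]
    rw [neg_eq_neg_one_mul, ← Complex.exp_pi_mul_I, ← Complex.exp_add,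
      Complex.exp_eq_exp_iff_exists_int]
    exact ⟨p.1, by push_cast; ring⟩

/-- Weierstrass' three-term relation. -/
lemma theta1_three_term (hτ : 0 < τ.im) (a b c d : ℂ) :
    theta1 τ (a + b) * theta1 τ (a - b) * (theta1 τ (c + d) * theta1 τ (c - d)) -
      theta1 τ (a + c) * theta1 τ (a - c) * (theta1 τ (b + d) * theta1 τ (b - d)) +
      theta1 τ (a + d) * theta1 τ (a - d) * (theta1 τ (b + c) * theta1 τ (b - c)) = 0 := by
  simp only [theta1_add_mul_theta1_sub hτ]
  ring

/-- If `z₀` is a zero of `θ₁`, then `θ₁(s - z₀) / θ₁(s)` is a multiplicative function of `s`. -/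
lemma theta1_cross_ratio (hτ : 0 < τ.im) {z₀ : ℂ} (h0 : theta1 τ z₀ = 0) {s t s' t' : ℂ}
    (h : s + t = s' + t') :
    theta1 τ (s - z₀) * theta1 τ (t - z₀) * (theta1 τ s' * theta1 τ t') =
      theta1 τ s * theta1 τ t * (theta1 τ (s' - z₀) * theta1 τ (t' - z₀)) := by
  obtain rfl : t = s' + t' - s := by linear_combination h
  have key := theta1_three_term hτ ((s' + t') / 2) (z₀ - (s' + t') / 2)
    (s - (s' + t') / 2) ((s' - t') / 2)
  have e1 := theta1_neg τ (s - z₀)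
  have e2 := theta1_neg τ (s' + t' - s - z₀)
  have e3 := theta1_neg τ (s' - z₀)
  have e4 := theta1_neg τ (t' - z₀)
  ring_nf at key e1 e2 e3 e4 ⊢
  simp only [h0] at key
  simp only [sub_eq_add_neg, add_comm, add_left_comm, add_assoc] at key e1 e2 e3 e4 ⊢
  simp only [e1, e2, e3, e4] at key
  linear_combination key

lemma exists_theta1_mul_ne_zero (hτ : 0 < τ.im) {w : ℂ} (hw : theta1 τ w ≠ 0) (z₀ : ℂ) :
    ∃ t, theta1 τ t ≠ 0 ∧ theta1 τ (t - z₀) ≠ 0 := by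
  by_contra! h
  have hd := differentiable_theta1 hτ
  have hd' : Differentiable ℂ fun t => theta1 τ (t - z₀) :=
    hd.comp (differentiable_id.sub_const z₀)
  have hmul : ∀ t ∈ Set.univ, theta1 τ t * theta1 τ (t - z₀) = 0 := fun t _ => by
    by_cases ht : theta1 τ t = 0
    · rw [ht, zero_mul]
    · rw [h t ht, mul_zero]
  rcases AnalyticOnNhd.eq_zero_or_eq_zero_of_mul_eq_zero (U := Set.univ)
    (fun z _ => hd.analyticAt z) (fun z _ => hd'.analyticAt z) hmul isPreconnected_univ with h | h
  · exact hw (h w trivial)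
  · exact hw (by simpa using h (w + z₀) trivial)

/-- A zero of `θ₁` gives rise to a quasi-period of `θ₁`. -/
lemma exists_quasiperiod_of_theta1_eq_zero (hτ : 0 < τ.im) {w : ℂ} (hw : theta1 τ w ≠ 0) {z₀ : ℂ}
    (h0 : theta1 τ z₀ = 0) :
    ∃ c k : ℂ, k ≠ 0 ∧ ∀ s, theta1 τ (s - z₀) * Complex.exp (c * s) = k * theta1 τ s := by
  obtain ⟨t, ht, ht'⟩ := exists_theta1_mul_ne_zero hτ hw z₀
  have hd := differentiable_theta1 hτ
  set θ := theta1 τ with hθ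
  have hsub (s : ℂ) : HasDerivAt (fun s => θ (s - z₀)) (deriv θ (s - z₀)) s :=
    (hd (s - z₀)).hasDerivAt.comp_sub_const s z₀
  have hadd {f : ℂ → ℂ} (hf : Differentiable ℂ f) (s : ℂ) :
      HasDerivAt (fun h => f (s + h)) (deriv f s) 0 := by
    have := (hf (s + 0)).hasDerivAt.comp_const_add s 0
    rwa [add_zero] at this
  have hd' : Differentiable ℂ (fun s => θ (s - z₀)) := fun s => (hsub s).differentiableAt
  have ode (s : ℂ) : θ (s - z₀) * θ t * (deriv θ (t - z₀) * θ s + θ (t - z₀) * deriv θ s) =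
      θ s * θ (t - z₀) * (deriv θ t * θ (s - z₀) + θ t * deriv θ (s - z₀)) := by
    have h1 := (((hadd hd' t).mul (hadd hd s)).const_mul (θ (s - z₀) * θ t)).deriv
    have h2 := (((hadd hd t).mul (hadd hd' s)).const_mul (θ s * θ (t - z₀))).deriv
    simp only [add_zero, (hsub _).deriv] at h1 h2
    rw [← h1, ← h2]
    congr 1
    funext h
    have := theta1_cross_ratio hτ h0 (s := s) (t := t + h) (s' := s + h) (t' := t) (by ring)
    simp only [Pi.mul_apply]
    linear_combination this
  obtain ⟨c, hc⟩ : ∃ c, c = deriv θ t / θ t - deriv θ (t - z₀) / θ (t - z₀) := ⟨_, rfl⟩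
  have ode' (s : ℂ) : θ (s - z₀) * deriv θ s = θ s * deriv θ (s - z₀) + c * θ s * θ (s - z₀) := by
    rw [hc]
    field_simp
    linear_combination ode s
  let f : ℂ → ℂ := fun s => θ (s - z₀) * Complex.exp (c * s)
  have hf (s : ℂ) : HasDerivAt f (deriv θ (s - z₀) * Complex.exp (c * s) +
      θ (s - z₀) * (Complex.exp (c * s) * c)) s := by
    have := ((hasDerivAt_id s).const_mul c).cexp
    simp only [id, mul_one] at this
    exact (hsub s).mul this
  have hfd : Differentiable ℂ f := fun s => (hf s).differentiableAt
  obtain ⟨ε, hε, hball⟩ := Metric.mem_nhds_iff.1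
    (hd.continuous.continuousAt.eventually_ne (x := t) ht)
  have hq (s : ℂ) (hs : s ∈ Metric.ball t ε) : HasDerivAt (fun s => f s / θ s) 0 s := by
    have hs0 : θ s ≠ 0 := hball hs
    have := (hf s).div (hd s).hasDerivAt hs0
    refine this.congr_deriv (div_eq_zero_iff.2 (Or.inl ?_))
    linear_combination -Complex.exp (c * s) * ode' s
  refine ⟨c, f t / θ t, div_ne_zero (mul_ne_zero ht' (Complex.exp_ne_zero _)) ht, ?_⟩
  refine congrFun (AnalyticOnNhd.eq_of_eventuallyEq (f := f) (g := fun s => f t / θ t * θ s)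
    (z₀ := t) (fun z _ => hfd.analyticAt z) (fun z _ => (hd.const_mul _).analyticAt z) ?_)
  filter_upwards [Metric.ball_mem_nhds t hε] with s hs
  have hconst := Metric.isOpen_ball.is_const_of_deriv_eq_zero (convex_ball t ε).isPreconnected
    (fun s hs => (hq s hs).differentiableAt.differentiableWithinAt) (fun s hs => (hq s hs).deriv)
    hs (Metric.mem_ball_self hε)
  have hs0 : θ s ≠ 0 := hball hs
  exact (div_eq_iff hs0).1 hconst

/-- In the strip `|Im z| < Im τ`, the zeros of `θ₁` are integers. -/
lemma theta1_ne_zero (hτ : 0 < τ.im) {w : ℂ} (hw : theta1 τ w ≠ 0) {z₀ : ℂ}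
    (him : |z₀.im| < τ.im) (hz : ∀ n : ℤ, z₀ ≠ n) : theta1 τ z₀ ≠ 0 := by
  intro h0
  obtain ⟨c, k, hk, h⟩ := exists_quasiperiod_of_theta1_eq_zero hτ hw h0
  have hkw : k * theta1 τ w ≠ 0 := mul_ne_zero hk hw
  have hc : Complex.exp c = 1 := by
    have h1 := h (w + 1)
    rw [theta1_add_one, show w + 1 - z₀ = w - z₀ + 1 by ring, theta1_add_one, mul_add, mul_one,
      Complex.exp_add] at h1
    refine mul_left_cancel₀ hkw ?_
    linear_combination -h1 - Complex.exp c * h w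
  have hc' : Complex.exp (2 * Real.pi * I * z₀ + c * τ) = 1 := by
    have h1 := h (w + τ)
    rw [theta1_add_period, show w + τ - z₀ = w - z₀ + τ by ring, theta1_add_period, mul_add c,
      Complex.exp_add, show (-Real.pi * I * (τ + 2 * (w - z₀)) : ℂ) =
        -Real.pi * I * (τ + 2 * w) + 2 * Real.pi * I * z₀ by ring, Complex.exp_add] at h1
    rw [Complex.exp_add]
    refine mul_left_cancel₀ hkw (mul_left_cancel₀
      (Complex.exp_ne_zero (-Real.pi * I * (τ + 2 * w))) ?_)
    linear_combination -h1 - Complex.exp (-Real.pi * I * (τ + 2 * w)) *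
      Complex.exp (2 * Real.pi * I * z₀) * Complex.exp (c * τ) * h w
  obtain ⟨n, rfl⟩ := Complex.exp_eq_one_iff.1 hc
  obtain ⟨m, hm⟩ := Complex.exp_eq_one_iff.1 hc'
  have hz₀ : z₀ = m - n * τ := by
    refine mul_left_cancel₀ Complex.two_pi_I_ne_zero ?_
    linear_combination hm
  have him' : z₀.im = -(n * τ.im) := by simp [hz₀]
  rw [him', abs_neg, abs_mul, abs_of_pos hτ] at him
  have hn1 : |(n : ℝ)| < 1 := by nlinarith
  have hn : n = 0 := by
    rw [← Int.abs_lt_one_iff]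
    exact_mod_cast hn1
  exact hz m (by simp [hz₀, hn])

end Theta

/-! ### The weights as functions of the difference of neighbouring heights -/

section Weights

/-- The weight of a pair of coinciding paths, `x` being the relative height. -/
noncomputable def straightWeight (t : ℂ → ℂ) (d x u : ℂ) : ℂ := t (x - u) * d / t x

/-- The weight of a pair of distinct paths, `x` being the relative height. -/
noncomputable def crossWeight (t : ℂ → ℂ) (d μ x u : ℂ) : ℂ :=
  t u * t (x - μ) * d / (t x * t (-μ))

lemma weights_straight {t : ℂ → ℂ} (hodd : ∀ z, t (-z) = -t z)
    (h3 : ∀ a b c d, t (a + b) * t (a - b) * (t (c + d) * t (c - d)) -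
      t (a + c) * t (a - c) * (t (b + d) * t (b - d)) +
      t (a + d) * t (a - d) * (t (b + c) * t (b - c)) = 0)
    (d : ℂ) {μ x y : ℂ} (u v : ℂ)
    (hμ : t μ ≠ 0) (hx : t x ≠ 0) (hy : t y ≠ 0) (hxy : t (x + y) ≠ 0) :
    straightWeight t d y u * straightWeight t d x (u + v) * straightWeight t d y v +
      crossWeight t d μ y u * straightWeight t d (x + y) (u + v) * crossWeight t d μ (-y) v =
    straightWeight t d x v * straightWeight t d y (u + v) * straightWeight t d x u +
      crossWeight t d μ x v * straightWeight t d (x + y) (u + v) * crossWeight t d μ (-x) u := by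
  have k1 : t x * t (x - (u + v)) * (t (y - v) * t (y - u)) -
      t (x + y - (u + v)) * t (x - y) * (t u * t v) -
      t (x - v) * t (x - u) * (t y * t (y - (u + v))) = 0 := by
    have k := h3 (x - (u + v) / 2) ((u + v) / 2) (y - (u + v) / 2) ((u - v) / 2)
    have e := hodd (y - (u + v))
    ring_nf at k e ⊢
    rw [e] at k
    linear_combination k
  have k2 := h3 x y μ 0
  have ex : t (-x - μ) = -t (x + μ) := by rw [← hodd, neg_add']
  have ey : t (-y - μ) = -t (y + μ) := by rw [← hodd, neg_add']
  simp only [add_zero, sub_zero] at k2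
  simp only [straightWeight, crossWeight, hodd x, hodd y, hodd μ, ex, ey]
  field_simp
  linear_combination d ^ 3 * (t (x + y) * t μ ^ 2 * k1 +
    t u * t v * t (x + y - (u + v)) * k2)

lemma weights_right {t : ℂ → ℂ} (hodd : ∀ z, t (-z) = -t z)
    (h3 : ∀ a b c d, t (a + b) * t (a - b) * (t (c + d) * t (c - d)) -
      t (a + c) * t (a - c) * (t (b + d) * t (b - d)) +
      t (a + d) * t (a - d) * (t (b + c) * t (b - c)) = 0)
    (d : ℂ) {μ x y : ℂ} (u v : ℂ)
    (hμ : t μ ≠ 0) (hx : t x ≠ 0) (hy : t y ≠ 0) (hxy : t (x + y) ≠ 0) :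
    straightWeight t d y u * straightWeight t d x (u + v) * crossWeight t d μ y v +
      crossWeight t d μ y u * straightWeight t d (x + y) (u + v) * straightWeight t d (-y) v =
    straightWeight t d x v * crossWeight t d μ y (u + v) * straightWeight t d (x + y) u := by
  have k : t (y - u) * t (x - (u + v)) * t v * t (x + y) +
      t u * t (x + y - (u + v)) * t (y + v) * t x -
      t (x - v) * t (u + v) * t (x + y - u) * t y = 0 := by
    have k := h3 ((x + y + v) / 2) ((x + y - v) / 2) ((x + y - 2 * u - v) / 2) ((y - x + v) / 2)
    ring_nf at k ⊢
    linear_combination k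
  have e : t (-y - v) = -t (y + v) := by rw [← hodd, neg_add']
  simp only [straightWeight, crossWeight, hodd y, hodd μ, e]
  field_simp
  linear_combination -(d ^ 3 * t (y - μ)) * k

lemma weights_left {t : ℂ → ℂ} (hodd : ∀ z, t (-z) = -t z)
    (h3 : ∀ a b c d, t (a + b) * t (a - b) * (t (c + d) * t (c - d)) -
      t (a + c) * t (a - c) * (t (b + d) * t (b - d)) +
      t (a + d) * t (a - d) * (t (b + c) * t (b - c)) = 0)
    (d : ℂ) {μ x y : ℂ} (u v : ℂ)
    (hμ : t μ ≠ 0) (hx : t x ≠ 0) (hy : t y ≠ 0) (hxy : t (x + y) ≠ 0) :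
    straightWeight t d y u * crossWeight t d μ x (u + v) * straightWeight t d (x + y) v =
    straightWeight t d x v * straightWeight t d y (u + v) * crossWeight t d μ x u +
      crossWeight t d μ x v * straightWeight t d (x + y) (u + v) * straightWeight t d (-x) u := by
  rw [add_comm x y] at hxy ⊢
  rw [add_comm u v]
  exact (weights_right hodd h3 d v u hμ hy hx hxy).symm

end Weights

/-! ### Shifted sequences and evaluation of the Boltzmann weights -/

section Shift

variable {μ : ℝ}

lemma shiftSeq_same (μ : ℝ) (l : ℤ → ℂ) (i : ℤ) : shiftSeq μ l i i = l i + μ := if_pos rfl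

lemma shiftSeq_of_ne (μ : ℝ) (l : ℤ → ℂ) {i j : ℤ} (h : j ≠ i) : shiftSeq μ l i j = l j :=
  if_neg h

lemma shiftSeq_comm (μ : ℝ) (l : ℤ → ℂ) (i j : ℤ) :
    shiftSeq μ (shiftSeq μ l i) j = shiftSeq μ (shiftSeq μ l j) i := by
  funext n
  simp only [shiftSeq]
  split_ifs <;> rfl

lemma shiftSeq_injective (hμ : μ ≠ 0) (l : ℤ → ℂ) : Function.Injective (shiftSeq μ l) := by
  intro i j h
  by_contra hij
  have := congrFun h i
  rw [shiftSeq_same, shiftSeq_of_ne μ l hij] at this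
  exact hμ (by simpa using this)

lemma shiftSeq_apply (μ : ℝ) (l : ℤ → ℂ) (i n : ℤ) :
    shiftSeq μ l i n = l n + ((if n = i then 1 else 0 : ℤ) : ℂ) * μ := by
  unfold shiftSeq
  split_ifs <;> simp

/-- The endpoint of a path of length three determines its steps up to permutation. -/
lemma shiftSeq_three_eq (hμ : μ ≠ 0) {l : ℤ → ℂ} {i j k a b c : ℤ}
    (h : shiftSeq μ (shiftSeq μ (shiftSeq μ l i) j) k =
      shiftSeq μ (shiftSeq μ (shiftSeq μ l a) b) c) :
    (a = i ∧ b = j ∧ c = k) ∨ (a = i ∧ b = k ∧ c = j) ∨ (a = j ∧ b = i ∧ c = k) ∨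
      (a = j ∧ b = k ∧ c = i) ∨ (a = k ∧ b = i ∧ c = j) ∨ (a = k ∧ b = j ∧ c = i) := by
  have count (n : ℤ) : (if n = i then 1 else 0 : ℤ) + (if n = j then 1 else 0) +
      (if n = k then 1 else 0) =
      (if n = a then 1 else 0) + (if n = b then 1 else 0) + (if n = c then 1 else 0) := by
    have hn := congrFun h n
    simp only [shiftSeq_apply, add_assoc, add_right_inj, ← add_mul] at hn
    rw [add_assoc, add_assoc]
    exact_mod_cast mul_right_cancel₀ (Complex.ofReal_ne_zero.mpr hμ) hn
  have hi := count i
  have hj := count j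
  have hk := count k
  have ha := count a
  have hb := count b
  clear h count
  grind (splits := 40)

/-- The relative height seen by the step `i` followed by the step `j`. -/
noncomputable def relHeight (μ : ℝ) (l : ℤ → ℂ) (i j : ℤ) : ℂ := if i = j then μ else l j - l i

lemma BW_straight (hμ : μ ≠ 0) (τ : ℂ) {l κ ν : ℤ → ℂ} (ξ : ℂ) {i j : ℤ}
    (hκ : κ = shiftSeq μ l i) (hν : ν = shiftSeq μ κ j) :
    BW τ μ κ l ξ ν κ = straightWeight (theta1 τ) (deriv (theta1 τ) 0) (relHeight μ l i j) ξ := by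
  subst hν hκ
  unfold BW straightWeight relHeight
  by_cases hij : i = j
  · subst hij
    rw [if_pos ⟨i, rfl, rfl, rfl⟩, if_pos rfl]
  · rw [if_neg, dif_pos ⟨i, j, hij, rfl, rfl, rfl⟩, if_neg hij]
    · generalize_proofs h h'
      have e1 := shiftSeq_injective hμ l h'.choose_spec.2.1
      have e2 := shiftSeq_injective hμ _ (h'.choose_spec.2.2.2.trans
        (congrArg (fun a => shiftSeq μ (shiftSeq μ l a) h'.choose) e1.symm))
      have key : ∀ a b, i = a → j = b →
          theta1 τ (l b - l a - ξ) * deriv (theta1 τ) 0 / theta1 τ (l b - l a) =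
            theta1 τ (l j - l i - ξ) * deriv (theta1 τ) 0 / theta1 τ (l j - l i) := by
        rintro _ _ rfl rfl
        rfl
      exact key _ _ e1 e2
    · rintro ⟨m, h1, -, h2⟩
      obtain rfl := shiftSeq_injective hμ l h1
      exact hij (shiftSeq_injective hμ _ h2).symm

lemma BW_cross (hμ : μ ≠ 0) (τ : ℂ) {l κ κ' ν : ℤ → ℂ} (ξ : ℂ) {i j : ℤ} (hij : i ≠ j)
    (hκ : κ = shiftSeq μ l i) (hκ' : κ' = shiftSeq μ l j) (hν : ν = shiftSeq μ κ j) :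
    BW τ μ κ' l ξ ν κ =
      crossWeight (theta1 τ) (deriv (theta1 τ) 0) μ (relHeight μ l i j) ξ := by
  subst hν hκ hκ'
  unfold BW crossWeight relHeight
  rw [if_neg, dif_neg, dif_pos ⟨i, j, hij, rfl, rfl, rfl⟩, if_neg hij]
  · generalize_proofs h h'
    have key : ∀ a b, i = a → j = b →
        theta1 τ ξ * theta1 τ (l b - l a - μ) * deriv (theta1 τ) 0 /
            (theta1 τ (l b - l a) * theta1 τ (-μ)) =
          theta1 τ ξ * theta1 τ (l j - l i - μ) * deriv (theta1 τ) 0 /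
            (theta1 τ (l j - l i) * theta1 τ (-μ)) := by
      rintro _ _ rfl rfl
      rfl
    exact key _ _ (shiftSeq_injective hμ l h'.choose_spec.2.1)
      (shiftSeq_injective hμ l h'.choose_spec.2.2.1)
  · rintro ⟨m, n, -, h1, h2, -⟩
    exact hij (shiftSeq_injective hμ l (h1.trans h2.symm))
  · rintro ⟨m, h1, h2, -⟩
    exact hij (shiftSeq_injective hμ l (h1.trans h2.symm))

lemma exists_of_BW_ne_zero {τ ξ : ℂ} {l κ κ' ν : ℤ → ℂ} (h : BW τ μ κ' l ξ ν κ ≠ 0) :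
    ∃ i j, κ = shiftSeq μ l i ∧ ν = shiftSeq μ κ j ∧
      (κ' = shiftSeq μ l i ∨ κ' = shiftSeq μ l j) := by
  unfold BW at h
  split_ifs at h with h1 h2 h3
  · obtain ⟨i, rfl, h1, h2⟩ := h1
    exact ⟨i, i, rfl, h2, .inl h1⟩
  · obtain ⟨i, j, -, rfl, h1, h2⟩ := h2
    exact ⟨i, j, rfl, h2, .inl h1⟩
  · obtain ⟨i, j, -, rfl, h1, h2⟩ := h3
    exact ⟨i, j, rfl, h2, .inr h1⟩
  · exact absurd rfl h

/-- The intermediate sequence of a nonzero weight is reached by one of the two steps. -/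
lemma BW_eq_zero (hμ : μ ≠ 0) (τ : ℂ) {l κ κ' ν : ℤ → ℂ} (ξ : ℂ) {i j m : ℤ}
    (hκ : κ = shiftSeq μ l i) (hν : ν = shiftSeq μ κ j) (hκ' : κ' = shiftSeq μ l m)
    (hi : m ≠ i) (hj : m ≠ j) : BW τ μ κ' l ξ ν κ = 0 := by
  by_contra h
  obtain ⟨i', j', h1, h2, h3⟩ := exists_of_BW_ne_zero h
  obtain rfl := shiftSeq_injective hμ l (hκ.symm.trans h1)
  obtain rfl := shiftSeq_injective hμ κ (hν.symm.trans h2)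
  rw [hκ'] at h3
  rcases h3 with h3 | h3
  · exact hi (shiftSeq_injective hμ l h3)
  · exact hj (shiftSeq_injective hμ l h3)

/-- A nonzero weight is attached to paths which agree or differ by a transposition of steps. -/
lemma BW_eq_zero' (hμ : μ ≠ 0) (τ : ℂ) {l κ κ' ν : ℤ → ℂ} (ξ : ℂ) {i j m : ℤ}
    (hκ' : κ' = shiftSeq μ l i) (hν : ν = shiftSeq μ κ' j) (hκ : κ = shiftSeq μ l m)
    (hi : m ≠ i) (hj : m ≠ j) : BW τ μ κ' l ξ ν κ = 0 := by
  by_contra h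
  obtain ⟨i', j', h1, h2, h3⟩ := exists_of_BW_ne_zero h
  obtain rfl := shiftSeq_injective hμ l (hκ.symm.trans h1)
  rcases h3 with h3 | h3
  · exact hi (shiftSeq_injective hμ l (h3.symm.trans hκ'))
  · rw [h1, shiftSeq_comm, ← h3, hν] at h2
    exact hj (shiftSeq_injective hμ κ' h2.symm)

end Shift

/-! ### The two sides of the star–triangle relation -/

section StarTriangle

variable {μ : ℝ}

lemma relHeight_self (μ : ℝ) (l : ℤ → ℂ) (i : ℤ) : relHeight μ l i i = μ := if_pos rfl

lemma relHeight_swap (μ : ℝ) (l : ℤ → ℂ) {i j : ℤ} (h : i ≠ j) :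
    relHeight μ l j i = -relHeight μ l i j := by
  simp [relHeight, h, h.symm]

lemma relHeight_add (μ : ℝ) (l : ℤ → ℂ) (i : ℤ) {j k : ℤ} (h : j ≠ k) :
    relHeight μ l i j + relHeight μ (shiftSeq μ l i) j k = relHeight μ l i k := by
  simp only [relHeight, shiftSeq]
  grind

lemma relHeight_shift (μ : ℝ) (l : ℤ → ℂ) {i j : ℤ} (k : ℤ) (h : i ≠ j) :
    relHeight μ (shiftSeq μ l j) i k =
      relHeight μ l i j + relHeight μ (shiftSeq μ l i) j k := by
  simp only [relHeight, shiftSeq]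
  grind

lemma relHeight_shift_of_ne (μ : ℝ) (l : ℤ → ℂ) {i j m : ℤ} (hi : m ≠ i) (hj : m ≠ j) :
    relHeight μ (shiftSeq μ l m) i j = relHeight μ l i j := by
  simp only [relHeight, shiftSeq_of_ne μ l hi.symm, shiftSeq_of_ne μ l hj.symm]

/-- The summand on the left of the star–triangle relation. -/
noncomputable def leftTerm (τ : ℂ) (μ : ℝ) (l κ ν α β γ : ℤ → ℂ) (u v : ℂ) (κ' : ℤ → ℂ) : ℂ :=
  BW τ μ κ' κ u γ ν * BW τ μ α l (u + v) κ' κ * BW τ μ β α v γ κ'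

/-- The summand on the right of the star–triangle relation. -/
noncomputable def rightTerm (τ : ℂ) (μ : ℝ) (l κ ν α β γ : ℤ → ℂ) (u v : ℂ) (κ' : ℤ → ℂ) : ℂ :=
  BW τ μ κ' l v ν κ * BW τ μ β κ' (u + v) γ ν * BW τ μ α l u β κ'

lemma crossWeight_self (τ : ℂ) (d μ u : ℂ) : crossWeight (theta1 τ) d μ μ u = 0 := by
  simp [crossWeight, theta1_zero]

/-- The star–triangle relation when the two boundary paths from `l` to `γ` coincide. -/
lemma leftTerm_add_of_same {τ : ℂ} (hτ : 0 < τ.im) (hμ : μ ≠ 0)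
    (hne : ∀ l ∈ LamSet τ μ, ∀ p q, theta1 τ (relHeight μ l p q) ≠ 0)
    (hS : ∀ l ∈ LamSet τ μ, ∀ p, shiftSeq μ l p ∈ LamSet τ μ)
    {l κ ν γ : ℤ → ℂ} (hl : l ∈ LamSet τ μ) {i j k : ℤ}
    (hκ : κ = shiftSeq μ l i) (hν : ν = shiftSeq μ κ j) (hγ : γ = shiftSeq μ ν k) (u v : ℂ) :
    leftTerm τ μ l κ ν κ ν γ u v (shiftSeq μ κ j) +
      (if j = k then 0 else leftTerm τ μ l κ ν κ ν γ u v (shiftSeq μ κ k)) =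
    rightTerm τ μ l κ ν κ ν γ u v (shiftSeq μ l i) +
      (if i = j then 0 else rightTerm τ μ l κ ν κ ν γ u v (shiftSeq μ l j)) := by
  set d := deriv (theta1 τ) 0 with hd
  set x := relHeight μ l i j with hx
  set y := relHeight μ κ j k with hy
  have hL : leftTerm τ μ l κ ν κ ν γ u v (shiftSeq μ κ j) =
      straightWeight (theta1 τ) d y u * straightWeight (theta1 τ) d x (u + v) *
        straightWeight (theta1 τ) d y v := by
    rw [leftTerm, ← hν, BW_straight hμ τ u hν hγ, BW_straight hμ τ (u + v) hκ hν,
      BW_straight hμ τ v hν hγ]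
  have hL' : (if j = k then 0 else leftTerm τ μ l κ ν κ ν γ u v (shiftSeq μ κ k)) =
      crossWeight (theta1 τ) d μ y u * straightWeight (theta1 τ) d (x + y) (u + v) *
        crossWeight (theta1 τ) d μ (-y) v := by
    split_ifs with hjk
    · subst hjk
      rw [hy, relHeight_self, crossWeight_self, zero_mul, zero_mul]
    · rw [leftTerm, BW_cross hμ τ u hjk hν rfl hγ, BW_straight hμ τ (u + v) hκ rfl,
        BW_cross hμ τ v (Ne.symm hjk) rfl hν (by rw [hγ, hν, shiftSeq_comm]),
        relHeight_swap μ κ hjk, hx, hy, hκ, relHeight_add μ l i hjk]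
  have hR : rightTerm τ μ l κ ν κ ν γ u v (shiftSeq μ l i) =
      straightWeight (theta1 τ) d x v * straightWeight (theta1 τ) d y (u + v) *
        straightWeight (theta1 τ) d x u := by
    rw [rightTerm, ← hκ, BW_straight hμ τ v hκ hν, BW_straight hμ τ (u + v) hν hγ,
      BW_straight hμ τ u hκ hν]
  have hR' : (if i = j then 0 else rightTerm τ μ l κ ν κ ν γ u v (shiftSeq μ l j)) =
      crossWeight (theta1 τ) d μ x v * straightWeight (theta1 τ) d (x + y) (u + v) *
        crossWeight (theta1 τ) d μ (-x) u := by
    split_ifs with hij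
    · subst hij
      rw [hx, relHeight_self, crossWeight_self, zero_mul, zero_mul]
    · have hν' : ν = shiftSeq μ (shiftSeq μ l j) i := by rw [hν, hκ, shiftSeq_comm]
      rw [rightTerm, BW_cross hμ τ v hij hκ rfl hν, BW_straight hμ τ (u + v) hν' hγ,
        BW_cross hμ τ u (Ne.symm hij) rfl hκ hν', relHeight_swap μ l hij,
        relHeight_shift μ l k hij, ← hκ]
  rw [hL, hL', hR, hR']
  have hκΛ : κ ∈ LamSet τ μ := hκ ▸ hS l hl i
  have hμθ : theta1 τ μ ≠ 0 := relHeight_self μ l i ▸ hne l hl i i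
  by_cases hxy : i = j ∧ j = k
  · obtain ⟨rfl, rfl⟩ := hxy
    rw [hx, hy, relHeight_self, relHeight_self, crossWeight_self, crossWeight_self]
    ring
  · refine weights_straight (theta1_neg τ) (theta1_three_term hτ) d u v hμθ (hne l hl i j)
      (hne κ hκΛ j k) ?_
    rcases not_and_or.mp hxy with hij | hjk
    · rw [hx, hy, hκ, ← relHeight_shift μ l k hij]
      exact hne _ (hS l hl j) i k
    · rw [hx, hy, hκ, relHeight_add μ l i hjk]
      exact hne l hl i k

/-- The star–triangle relation when the two boundary paths differ in the last two steps. -/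
lemma leftTerm_add_of_swap_right {τ : ℂ} (hτ : 0 < τ.im) (hμ : μ ≠ 0)
    (hne : ∀ l ∈ LamSet τ μ, ∀ p q, theta1 τ (relHeight μ l p q) ≠ 0)
    (hS : ∀ l ∈ LamSet τ μ, ∀ p, shiftSeq μ l p ∈ LamSet τ μ)
    {l κ ν β γ : ℤ → ℂ} (hl : l ∈ LamSet τ μ) {i j k : ℤ}
    (hκ : κ = shiftSeq μ l i) (hν : ν = shiftSeq μ κ j) (hγ : γ = shiftSeq μ ν k)
    (hβ : β = shiftSeq μ κ k) (hjk : j ≠ k) (u v : ℂ) :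
    leftTerm τ μ l κ ν κ β γ u v (shiftSeq μ κ j) +
      (if j = k then 0 else leftTerm τ μ l κ ν κ β γ u v (shiftSeq μ κ k)) =
    rightTerm τ μ l κ ν κ β γ u v (shiftSeq μ l i) +
      (if i = j then 0 else rightTerm τ μ l κ ν κ β γ u v (shiftSeq μ l j)) := by
  have hγ' : γ = shiftSeq μ β j := by rw [hγ, hν, hβ, shiftSeq_comm]
  have hR' : (if i = j then 0 else rightTerm τ μ l κ ν κ β γ u v (shiftSeq μ l j)) = 0 := by
    split_ifs with hij
    · rfl
    · rw [rightTerm, BW_eq_zero' hμ τ u hκ hβ rfl (Ne.symm hij) hjk, mul_zero]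
  rw [hR', if_neg hjk, leftTerm, leftTerm, rightTerm, ← hν, ← hκ, ← hβ,
    BW_straight hμ τ u hν hγ, BW_straight hμ τ (u + v) hκ hν, BW_cross hμ τ v hjk hν hβ hγ,
    BW_cross hμ τ u hjk hν hβ hγ, BW_straight hμ τ (u + v) hκ hβ, BW_straight hμ τ v hβ hγ',
    BW_straight hμ τ v hκ hν, BW_cross hμ τ (u + v) hjk hν hβ hγ, BW_straight hμ τ u hκ hβ,
    relHeight_swap μ κ hjk, ← relHeight_add μ l i hjk, ← hκ, add_zero]
  refine weights_right (theta1_neg τ) (theta1_three_term hτ) _ u v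
    (relHeight_self μ l i ▸ hne l hl i i) (hne l hl i j) (hne κ (hκ ▸ hS l hl i) j k) ?_
  rw [hκ, relHeight_add μ l i hjk]
  exact hne l hl i k

/-- The star–triangle relation when the two boundary paths differ in the first two steps. -/
lemma leftTerm_add_of_swap_left {τ : ℂ} (hτ : 0 < τ.im) (hμ : μ ≠ 0)
    (hne : ∀ l ∈ LamSet τ μ, ∀ p q, theta1 τ (relHeight μ l p q) ≠ 0)
    (hS : ∀ l ∈ LamSet τ μ, ∀ p, shiftSeq μ l p ∈ LamSet τ μ)
    {l κ ν α γ : ℤ → ℂ} (hl : l ∈ LamSet τ μ) {i j k : ℤ}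
    (hκ : κ = shiftSeq μ l i) (hν : ν = shiftSeq μ κ j) (hγ : γ = shiftSeq μ ν k)
    (hα : α = shiftSeq μ l j) (hij : i ≠ j) (u v : ℂ) :
    leftTerm τ μ l κ ν α ν γ u v (shiftSeq μ κ j) +
      (if j = k then 0 else leftTerm τ μ l κ ν α ν γ u v (shiftSeq μ κ k)) =
    rightTerm τ μ l κ ν α ν γ u v (shiftSeq μ l i) +
      (if i = j then 0 else rightTerm τ μ l κ ν α ν γ u v (shiftSeq μ l j)) := by
  have hν' : ν = shiftSeq μ α i := by rw [hν, hκ, hα, shiftSeq_comm]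
  have hL' : (if j = k then 0 else leftTerm τ μ l κ ν α ν γ u v (shiftSeq μ κ k)) = 0 := by
    split_ifs with hjk
    · rfl
    · rw [leftTerm, BW_eq_zero hμ τ (u + v) hκ rfl hα (Ne.symm hij) hjk, mul_zero, zero_mul]
  rw [hL', if_neg hij, leftTerm, rightTerm, rightTerm, ← hν, ← hκ, ← hα,
    BW_straight hμ τ u hν hγ, BW_cross hμ τ (u + v) hij hκ hα hν, BW_straight hμ τ v hν' hγ,
    BW_straight hμ τ v hκ hν, BW_straight hμ τ (u + v) hν hγ, BW_cross hμ τ u hij hκ hα hν,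
    BW_cross hμ τ v hij hκ hα hν, BW_straight hμ τ (u + v) hν' hγ, BW_straight hμ τ u hα hν',
    relHeight_swap μ l hij, hα, relHeight_shift μ l k hij, ← hκ, add_zero]
  refine weights_left (theta1_neg τ) (theta1_three_term hτ) _ u v
    (relHeight_self μ l i ▸ hne l hl i i) (hne l hl i j) (hne κ (hκ ▸ hS l hl i) j k) ?_
  rw [hκ, ← relHeight_shift μ l k hij]
  exact hne _ (hS l hl j) i k

/-- The star–triangle relation when the first step of the path through `κ` is taken last by the
other path. -/
lemma leftTerm_add_of_rotate_left (τ : ℂ) (hμ : μ ≠ 0) {l κ ν α β γ : ℤ → ℂ} {i j k : ℤ}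
    (hκ : κ = shiftSeq μ l i) (hν : ν = shiftSeq μ κ j) (hγ : γ = shiftSeq μ ν k)
    (hα : α = shiftSeq μ l j) (hβ : β = shiftSeq μ α k) (hij : i ≠ j) (hik : i ≠ k) (u v : ℂ) :
    leftTerm τ μ l κ ν α β γ u v (shiftSeq μ κ j) +
      (if j = k then 0 else leftTerm τ μ l κ ν α β γ u v (shiftSeq μ κ k)) =
    rightTerm τ μ l κ ν α β γ u v (shiftSeq μ l i) +
      (if i = j then 0 else rightTerm τ μ l κ ν α β γ u v (shiftSeq μ l j)) := by
  have hν' : ν = shiftSeq μ α i := by rw [hν, hκ, hα, shiftSeq_comm]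
  have hL' : (if j = k then 0 else leftTerm τ μ l κ ν α β γ u v (shiftSeq μ κ k)) = 0 := by
    split_ifs with hjk
    · rfl
    · rw [leftTerm, BW_eq_zero hμ τ (u + v) hκ rfl hα (Ne.symm hij) hjk, mul_zero, zero_mul]
  rw [hL', if_neg hij, leftTerm, rightTerm, rightTerm, ← hν, ← hκ, ← hα,
    BW_eq_zero' hμ τ u hα hβ hκ hij hik, BW_straight hμ τ u hν hγ,
    BW_cross hμ τ (u + v) hij hκ hα hν, BW_cross hμ τ v hik hν' hβ hγ,
    BW_cross hμ τ v hij hκ hα hν, BW_cross hμ τ (u + v) hik hν' hβ hγ,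
    BW_straight hμ τ u hα hβ, hκ, relHeight_shift_of_ne μ l hij hik]
  unfold crossWeight
  ring

/-- The star–triangle relation when the last step of the path through `κ` is taken first by the
other path. -/
lemma leftTerm_add_of_rotate_right (τ : ℂ) (hμ : μ ≠ 0) {l κ ν α β γ : ℤ → ℂ} {i j k : ℤ}
    (hκ : κ = shiftSeq μ l i) (hν : ν = shiftSeq μ κ j) (hγ : γ = shiftSeq μ ν k)
    (hα : α = shiftSeq μ l k) (hβ : β = shiftSeq μ α i) (hik : i ≠ k) (hjk : j ≠ k) (u v : ℂ) :
    leftTerm τ μ l κ ν α β γ u v (shiftSeq μ κ j) +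
      (if j = k then 0 else leftTerm τ μ l κ ν α β γ u v (shiftSeq μ κ k)) =
    rightTerm τ μ l κ ν α β γ u v (shiftSeq μ l i) +
      (if i = j then 0 else rightTerm τ μ l κ ν α β γ u v (shiftSeq μ l j)) := by
  have hβ' : β = shiftSeq μ κ k := by rw [hβ, hκ, hα, shiftSeq_comm]
  have hγ' : γ = shiftSeq μ β j := by rw [hγ, hν, hβ', shiftSeq_comm]
  have hR' : (if i = j then 0 else rightTerm τ μ l κ ν α β γ u v (shiftSeq μ l j)) = 0 := by
    split_ifs with hij
    · rfl
    · rw [rightTerm, BW_eq_zero' hμ τ u hα hβ rfl hjk (Ne.symm hij), mul_zero]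
  rw [hR', if_neg hjk, leftTerm, leftTerm, rightTerm, ← hν, ← hκ, ← hβ',
    BW_eq_zero hμ τ (u + v) hκ hν hα hik.symm hjk.symm, BW_cross hμ τ u hjk hν hβ' hγ,
    BW_cross hμ τ (u + v) hik hκ hα hβ', BW_straight hμ τ v hβ hγ',
    BW_straight hμ τ v hκ hν, BW_cross hμ τ (u + v) hjk hν hβ' hγ,
    BW_cross hμ τ u hik hκ hα hβ', hα, relHeight_shift_of_ne μ l hik.symm hjk.symm]
  unfold crossWeight
  ring

/-- The star–triangle relation when the two boundary paths take three distinct steps in opposite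
orders. -/
lemma leftTerm_add_of_reverse (τ : ℂ) (hμ : μ ≠ 0) {l κ ν α β γ : ℤ → ℂ} {i j k : ℤ}
    (hκ : κ = shiftSeq μ l i) (hν : ν = shiftSeq μ κ j) (hγ : γ = shiftSeq μ ν k)
    (hα : α = shiftSeq μ l k) (hβ : β = shiftSeq μ α j) (hij : i ≠ j) (hik : i ≠ k) (hjk : j ≠ k)
    (u v : ℂ) :
    leftTerm τ μ l κ ν α β γ u v (shiftSeq μ κ j) +
      (if j = k then 0 else leftTerm τ μ l κ ν α β γ u v (shiftSeq μ κ k)) =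
    rightTerm τ μ l κ ν α β γ u v (shiftSeq μ l i) +
      (if i = j then 0 else rightTerm τ μ l κ ν α β γ u v (shiftSeq μ l j)) := by
  have hν' : ν = shiftSeq μ (shiftSeq μ l j) i := by rw [hν, hκ, shiftSeq_comm]
  have hβ' : β = shiftSeq μ (shiftSeq μ l j) k := by rw [hβ, hα, shiftSeq_comm]
  have hκk : shiftSeq μ κ k = shiftSeq μ α i := by rw [hκ, hα, shiftSeq_comm]
  have hγ' : γ = shiftSeq μ (shiftSeq μ κ k) j := by rw [hγ, hν, shiftSeq_comm]
  rw [if_neg hij, if_neg hjk, leftTerm, leftTerm, rightTerm, rightTerm, ← hν, ← hκ,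
    BW_eq_zero hμ τ (u + v) hκ hν hα hik.symm hjk.symm,
    BW_eq_zero' hμ τ u hα hβ hκ hik hij, BW_cross hμ τ u hjk hν rfl hγ,
    BW_cross hμ τ (u + v) hik hκ hα rfl, BW_cross hμ τ v hij hκk hβ hγ',
    BW_cross hμ τ v hij hκ rfl hν, BW_cross hμ τ (u + v) hik hν' hβ' hγ,
    BW_cross hμ τ u hjk rfl hα hβ', hα, hκ, relHeight_shift_of_ne μ l hik.symm hjk.symm,
    relHeight_shift_of_ne μ l hij hik, relHeight_shift_of_ne μ l hij.symm hjk]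
  ring

/-- The star–triangle relation for two paths from `l` to `γ`. -/
lemma leftTerm_add_eq_rightTerm_add {τ : ℂ} (hτ : 0 < τ.im) (hμ : μ ≠ 0)
    (hne : ∀ l ∈ LamSet τ μ, ∀ p q, theta1 τ (relHeight μ l p q) ≠ 0)
    (hS : ∀ l ∈ LamSet τ μ, ∀ p, shiftSeq μ l p ∈ LamSet τ μ)
    {l κ ν α β γ : ℤ → ℂ} (hl : l ∈ LamSet τ μ) {i j k a b c : ℤ}
    (hκ : κ = shiftSeq μ l i) (hν : ν = shiftSeq μ κ j) (hγ : γ = shiftSeq μ ν k)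
    (hα : α = shiftSeq μ l a) (hβ : β = shiftSeq μ α b) (hγ' : γ = shiftSeq μ β c) (u v : ℂ) :
    leftTerm τ μ l κ ν α β γ u v (shiftSeq μ κ j) +
      (if j = k then 0 else leftTerm τ μ l κ ν α β γ u v (shiftSeq μ κ k)) =
    rightTerm τ μ l κ ν α β γ u v (shiftSeq μ l i) +
      (if i = j then 0 else rightTerm τ μ l κ ν α β γ u v (shiftSeq μ l j)) := by
  have same (hα' : α = κ) (hβ' : β = ν) :
      leftTerm τ μ l κ ν α β γ u v (shiftSeq μ κ j) +
        (if j = k then 0 else leftTerm τ μ l κ ν α β γ u v (shiftSeq μ κ k)) =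
      rightTerm τ μ l κ ν α β γ u v (shiftSeq μ l i) +
        (if i = j then 0 else rightTerm τ μ l κ ν α β γ u v (shiftSeq μ l j)) := by
    rw [hα', hβ']
    exact leftTerm_add_of_same hτ hμ hne hS hl hκ hν hγ u v
  have swapRight (ha : a = i) (hb : b = k) :
      leftTerm τ μ l κ ν α β γ u v (shiftSeq μ κ j) +
        (if j = k then 0 else leftTerm τ μ l κ ν α β γ u v (shiftSeq μ κ k)) =
      rightTerm τ μ l κ ν α β γ u v (shiftSeq μ l i) +
        (if i = j then 0 else rightTerm τ μ l κ ν α β γ u v (shiftSeq μ l j)) := by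
    have hακ : α = κ := by rw [hα, hκ, ha]
    by_cases hjk : j = k
    · exact same hακ (by rw [hβ, hν, hακ, hb, hjk])
    · rw [hακ]
      exact leftTerm_add_of_swap_right hτ hμ hne hS hl hκ hν hγ (by rw [hβ, hακ, hb]) hjk u v
  have swapLeft (ha : a = j) (hb : b = i) :
      leftTerm τ μ l κ ν α β γ u v (shiftSeq μ κ j) +
        (if j = k then 0 else leftTerm τ μ l κ ν α β γ u v (shiftSeq μ κ k)) =
      rightTerm τ μ l κ ν α β γ u v (shiftSeq μ l i) +
        (if i = j then 0 else rightTerm τ μ l κ ν α β γ u v (shiftSeq μ l j)) := by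
    have hβν : β = ν := by rw [hβ, hα, hν, hκ, ha, hb, shiftSeq_comm]
    by_cases hij : i = j
    · exact same (by rw [hα, hκ, ha, hij]) hβν
    · rw [hβν]
      exact leftTerm_add_of_swap_left hτ hμ hne hS hl hκ hν hγ (by rw [hα, ha]) hij u v
  have hend : shiftSeq μ (shiftSeq μ (shiftSeq μ l i) j) k =
      shiftSeq μ (shiftSeq μ (shiftSeq μ l a) b) c := by
    rw [← hκ, ← hν, ← hγ, ← hα, ← hβ, hγ']
  have hperm := shiftSeq_three_eq hμ hend
  by_cases hij : i = j
  · by_cases hik : i = k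
    · exact same (by rw [hα, hκ]; congr 1; omega) (by rw [hβ, hα, hν, hκ]; congr <;> omega)
    · rcases eq_or_ne a k with ha | ha
      · exact leftTerm_add_of_rotate_right τ hμ hκ hν hγ (by rw [hα, ha])
          (by rw [hβ]; congr 1; omega) hik (by omega) u v
      · rcases eq_or_ne b k with hb | hb
        · exact swapRight (by omega) hb
        · exact swapLeft (by omega) (by omega)
  · rcases hperm with h | h | h | h | h | h
    · exact same (by rw [hα, hκ, h.1]) (by rw [hβ, hα, hν, hκ, h.1, h.2.1])
    · exact swapRight h.1 h.2.1
    · exact swapLeft h.1 h.2.1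
    · by_cases hik : i = k
      · exact swapLeft h.1 (by omega)
      · exact leftTerm_add_of_rotate_left τ hμ hκ hν hγ (by rw [hα, h.1]) (by rw [hβ, h.2.1])
          hij hik u v
    · by_cases hik : i = k
      · exact swapRight (by omega) (by omega)
      · by_cases hjk : j = k
        · exact swapLeft (by omega) h.2.1
        · exact leftTerm_add_of_rotate_right τ hμ hκ hν hγ (by rw [hα, h.1]) (by rw [hβ, h.2.1])
            hik hjk u v
    · by_cases hik : i = k
      · exact same (by rw [hα, hκ, h.1, hik]) (by rw [hβ, hα, hν, hκ, h.1, h.2.1, hik])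
      · by_cases hjk : j = k
        · exact leftTerm_add_of_rotate_left τ hμ hκ hν hγ (by rw [hα, h.1, hjk])
            (by rw [hβ, h.2.1, hjk]) hij hik u v
        · exact leftTerm_add_of_reverse τ hμ hκ hν hγ (by rw [hα, h.1]) (by rw [hβ, h.2.1])
            hij hik hjk u v

end StarTriangle

/-! ### Admissible sequences and the sums over them -/

section Admissible

variable {τ : ℂ} {μ : ℝ}

lemma shiftSeq_mem_LamSet {l : ℤ → ℂ} (hl : l ∈ LamSet τ μ) (p : ℤ) :
    shiftSeq μ l p ∈ LamSet τ μ := by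
  refine ⟨fun i => ?_, fun i j hij => ?_⟩
  · rw [shiftSeq_apply]
    split_ifs <;> simpa using hl.1 i
  · rintro ⟨a, b, hab⟩
    refine hl.2 i j hij ⟨a, b - (if i = p then 1 else 0) + (if j = p then 1 else 0), ?_⟩
    rw [shiftSeq_apply, shiftSeq_apply] at hab
    push_cast at hab ⊢
    linear_combination hab

lemma theta1_relHeight_ne_zero (hτ : 0 < τ.im) (hμ : ∀ n : ℤ, μ ≠ (n : ℝ)) {w : ℂ}
    (hw : theta1 τ w ≠ 0) {l : ℤ → ℂ} (hl : l ∈ LamSet τ μ) (p q : ℤ) :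
    theta1 τ (relHeight μ l p q) ≠ 0 := by
  unfold relHeight
  split_ifs with h
  · exact theta1_ne_zero hτ hw (by simpa using hτ) fun n hn => hμ n (by exact_mod_cast hn)
  · refine theta1_ne_zero hτ hw ?_ fun n hn => hl.2 q p (Ne.symm h) ⟨n, 0, by simpa using hn⟩
    have h1 := abs_lt.mp (hl.1 p)
    have h2 := abs_lt.mp (hl.1 q)
    rw [Complex.sub_im, abs_lt]
    constructor <;> linarith

lemma BW_eq_zero_of_theta1_eq_zero (h : ∀ z, theta1 τ z = 0) (κ' l : ℤ → ℂ) (ξ : ℂ)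
    (ν κ : ℤ → ℂ) : BW τ μ κ' l ξ ν κ = 0 := by
  unfold BW
  simp [h]

lemma finite_and_finsum_mem_pair {X : Type*} (s : Set X) (f : X → ℂ) {P Q : X} (hP : P ∈ s)
    (hQ : Q ∈ s) (hf : ∀ x, f x ≠ 0 → x = P ∨ x = Q) :
    (s ∩ Function.support f).Finite ∧
      ((P = Q → ∑ᶠ x ∈ s, f x = f P) ∧ (P ≠ Q → ∑ᶠ x ∈ s, f x = f P + f Q)) := by
  have hsupp : s ∩ Function.support f = {P, Q} ∩ Function.support f := by
    ext x
    refine ⟨fun hx => ⟨hf x hx.2, hx.2⟩, ?_⟩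
    rintro ⟨rfl | rfl, hx⟩
    exacts [⟨hP, hx⟩, ⟨hQ, hx⟩]
  refine ⟨hsupp ▸ ((Set.finite_singleton Q).insert P).inter_of_left _, fun h => ?_, fun h => ?_⟩
  · subst h
    rw [finsum_mem_inter_support_eq f s _ hsupp, Set.pair_eq_singleton, finsum_mem_singleton]
  · rw [finsum_mem_inter_support_eq f s _ hsupp, finsum_mem_pair h]

lemma eq_or_eq_of_leftTerm_ne_zero (hμ : μ ≠ 0) {l κ ν α β γ x : ℤ → ℂ} {j k : ℤ}
    (hν : ν = shiftSeq μ κ j) (hγ : γ = shiftSeq μ ν k) {u v : ℂ}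
    (h : leftTerm τ μ l κ ν α β γ u v x ≠ 0) : x = shiftSeq μ κ j ∨ x = shiftSeq μ κ k := by
  obtain ⟨j', k', h1, h2, h3⟩ :=
    exists_of_BW_ne_zero (left_ne_zero_of_mul (left_ne_zero_of_mul h))
  obtain rfl := shiftSeq_injective hμ κ (hν.symm.trans h1)
  obtain rfl := shiftSeq_injective hμ ν (hγ.symm.trans h2)
  exact h3

lemma eq_or_eq_of_rightTerm_ne_zero (hμ : μ ≠ 0) {l κ ν α β γ x : ℤ → ℂ} {i j : ℤ}
    (hκ : κ = shiftSeq μ l i) (hν : ν = shiftSeq μ κ j) {u v : ℂ}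
    (h : rightTerm τ μ l κ ν α β γ u v x ≠ 0) : x = shiftSeq μ l i ∨ x = shiftSeq μ l j := by
  obtain ⟨i', j', h1, h2, h3⟩ :=
    exists_of_BW_ne_zero (left_ne_zero_of_mul (left_ne_zero_of_mul h))
  obtain rfl := shiftSeq_injective hμ l (hκ.symm.trans h1)
  obtain rfl := shiftSeq_injective hμ κ (hν.symm.trans h2)
  exact h3

lemma exists_other_step_of_BW_ne_zero {ξ : ℂ} {l κ κ' ν : ℤ → ℂ}
    (h : BW τ μ κ' l ξ ν κ ≠ 0) : ∃ i j, κ' = shiftSeq μ l i ∧ ν = shiftSeq μ κ' j := by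
  obtain ⟨i, j, h1, h2, h3 | h3⟩ := exists_of_BW_ne_zero h
  · exact ⟨i, j, h3, by rw [h2, h1, h3]⟩
  · exact ⟨j, i, h3, by rw [h2, h1, h3, shiftSeq_comm]⟩

/-- A nonzero summand forces the boundary sequences to form two paths from `l` to `γ`. -/
lemma exists_paths {l κ ν α β γ x : ℤ → ℂ} {u v : ℂ}
    (h : leftTerm τ μ l κ ν α β γ u v x ≠ 0 ∨ rightTerm τ μ l κ ν α β γ u v x ≠ 0) :
    ∃ i j k a b c, κ = shiftSeq μ l i ∧ ν = shiftSeq μ κ j ∧ γ = shiftSeq μ ν k ∧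
      α = shiftSeq μ l a ∧ β = shiftSeq μ α b ∧ γ = shiftSeq μ β c := by
  rcases h with h | h
  all_goals
    have h1 := left_ne_zero_of_mul (left_ne_zero_of_mul h)
    have h2 := right_ne_zero_of_mul (left_ne_zero_of_mul h)
    have h3 := right_ne_zero_of_mul h
  · obtain ⟨j, k, e1, e2, -⟩ := exists_of_BW_ne_zero h1
    obtain ⟨i, -, e3, -⟩ := exists_of_BW_ne_zero h2
    obtain ⟨a, -, e4, -⟩ := exists_other_step_of_BW_ne_zero h2
    obtain ⟨b, c, e5, e6⟩ := exists_other_step_of_BW_ne_zero h3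
    exact ⟨i, j, k, a, b, c, e3, e1, e2, e4, e5, e6⟩
  · obtain ⟨i, j, e1, e2, -⟩ := exists_of_BW_ne_zero h1
    obtain ⟨-, k, -, e3, -⟩ := exists_of_BW_ne_zero h2
    obtain ⟨-, c, -, e6⟩ := exists_other_step_of_BW_ne_zero h2
    obtain ⟨a, b, e4, e5⟩ := exists_other_step_of_BW_ne_zero h3
    exact ⟨i, j, k, a, b, c, e1, e2, e3, e4, e5, e6⟩

end Admissible

/-- The star–triangle relation for the Boltzmann weights of the IRF model:
both sums over `Λ` have finite support and are equal. -/
theorem star_triangle (τ : ℂ) (hτ : 0 < τ.im) (μ : ℝ) (hμ : ∀ n : ℤ, μ ≠ (n : ℝ))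
    (lam κ ν α β γ : ℤ → ℂ)
    (hlam : lam ∈ LamSet τ μ) (hκ : κ ∈ LamSet τ μ) (hν : ν ∈ LamSet τ μ)
    (hα : α ∈ LamSet τ μ) (hβ : β ∈ LamSet τ μ) (hγ : γ ∈ LamSet τ μ)
    (ξ₁ ξ₂ ξ₃ : ℂ) :
    (LamSet τ μ ∩ Function.support (fun κ' =>
      BW τ μ κ' κ (ξ₁ - ξ₂) γ ν * BW τ μ α lam (ξ₁ - ξ₃) κ' κ *
        BW τ μ β α (ξ₂ - ξ₃) γ κ')).Finite ∧
    (LamSet τ μ ∩ Function.support (fun κ' =>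
      BW τ μ κ' lam (ξ₂ - ξ₃) ν κ * BW τ μ β κ' (ξ₁ - ξ₃) γ ν *
        BW τ μ α lam (ξ₁ - ξ₂) β κ')).Finite ∧
    ∑ᶠ κ' ∈ LamSet τ μ,
        BW τ μ κ' κ (ξ₁ - ξ₂) γ ν * BW τ μ α lam (ξ₁ - ξ₃) κ' κ *
          BW τ μ β α (ξ₂ - ξ₃) γ κ' =
      ∑ᶠ κ' ∈ LamSet τ μ,
        BW τ μ κ' lam (ξ₂ - ξ₃) ν κ * BW τ μ β κ' (ξ₁ - ξ₃) γ ν *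
          BW τ μ α lam (ξ₁ - ξ₂) β κ' := by
  rw [← sub_add_sub_cancel ξ₁ ξ₂ ξ₃]
  set u := ξ₁ - ξ₂
  set v := ξ₂ - ξ₃
  change (LamSet τ μ ∩ Function.support (leftTerm τ μ lam κ ν α β γ u v)).Finite ∧
    (LamSet τ μ ∩ Function.support (rightTerm τ μ lam κ ν α β γ u v)).Finite ∧
    ∑ᶠ κ' ∈ LamSet τ μ, leftTerm τ μ lam κ ν α β γ u v κ' =
      ∑ᶠ κ' ∈ LamSet τ μ, rightTerm τ μ lam κ ν α β γ u v κ'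
  by_cases hzero : ∃ x, leftTerm τ μ lam κ ν α β γ u v x ≠ 0 ∨
      rightTerm τ μ lam κ ν α β γ u v x ≠ 0
  · obtain ⟨x, hx⟩ := hzero
    have hμ0 : μ ≠ 0 := by simpa using hμ 0
    obtain ⟨w, hw⟩ : ∃ w, theta1 τ w ≠ 0 := by
      by_contra! h
      simp [leftTerm, rightTerm, BW_eq_zero_of_theta1_eq_zero h] at hx
    obtain ⟨i, j, k, a, b, c, eκ, eν, eγ, eα, eβ, eγ'⟩ := exists_paths hx
    have hsum := leftTerm_add_eq_rightTerm_add hτ hμ0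
      (fun l hl => theta1_relHeight_ne_zero hτ hμ hw hl) (fun l hl => shiftSeq_mem_LamSet hl)
      hlam eκ eν eγ eα eβ eγ' u v
    obtain ⟨hfinL, hL, hL'⟩ := finite_and_finsum_mem_pair (LamSet τ μ)
      (leftTerm τ μ lam κ ν α β γ u v) (shiftSeq_mem_LamSet hκ j) (shiftSeq_mem_LamSet hκ k)
      fun x hx => eq_or_eq_of_leftTerm_ne_zero hμ0 eν eγ hx
    obtain ⟨hfinR, hR, hR'⟩ := finite_and_finsum_mem_pair (LamSet τ μ)
      (rightTerm τ μ lam κ ν α β γ u v) (shiftSeq_mem_LamSet hlam i) (shiftSeq_mem_LamSet hlam j)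
      fun x hx => eq_or_eq_of_rightTerm_ne_zero hμ0 eκ eν hx
    refine ⟨hfinL, hfinR, ?_⟩
    convert hsum using 1
    · split_ifs with h
      · rw [hL (by rw [h]), add_zero]
      · exact hL' fun e => h (shiftSeq_injective hμ0 κ e)
    · split_ifs with h
      · rw [hR (by rw [h]), add_zero]
      · exact hR' fun e => h (shiftSeq_injective hμ0 lam e)
  · push Not at hzero
    have hL : leftTerm τ μ lam κ ν α β γ u v = 0 := funext fun x => (hzero x).1
    have hR : rightTerm τ μ lam κ ν α β γ u v = 0 := funext fun x => (hzero x).2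
    simp [hL, hR]
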